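/- Let X be a partial EFX allocation for agents with non-degenerate cancelable valuations, let g be an unallocated item, and let C be a good g-cycle with induced decompositions X_j = T_j ∪ B_j for agents j on C. Then for every agent j on C at least one of the following holds: (good edge) there exist agents i and ℓ on C with i ▷_{B_j | B_ℓ} ℓ such that j lies on the directed path from ℓ to i along C; or (external edge) there exist an agent a not on C and an agent ℓ on C with a ▷_{B_j | B_ℓ} ℓ. -/

import Mathlib

namespace FairDivision

open Finset

/-- A valuation: nonnegative, zero on the empty set, monotone. -/
def IsValuation {ι : Type*} (v : Finset ι → ℝ) : Prop :=
  v ∅ = 0 ∧ (∀ S : Finset ι, 0 ≤ v S) ∧ ∀ ⦃S T : Finset ι⦄, S ⊆ T → v S ≤ v T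

/-- `v` is cancelable: `v (S ∪ {g}) > v (T ∪ {g})` implies `v S > v T`. -/
def Cancelable {ι : Type*} [DecidableEq ι] (v : Finset ι → ℝ) : Prop :=
  ∀ S T : Finset ι, ∀ g : ι, g ∉ S → g ∉ T →
    v (insert g S) > v (insert g T) → v S > v T

/-- `v` is non-degenerate: distinct bundles have distinct values. -/
def NonDegenerate {ι : Type*} (v : Finset ι → ℝ) : Prop :=
  ∀ S T : Finset ι, S ≠ T → v S ≠ v T

/-- `v'` respects `v`: every strict inequality of `v` is a strict inequality of `v'`. -/
def Respects {ι : Type*} (v' v : Finset ι → ℝ) : Prop :=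
  ∀ S T : Finset ι, v S > v T → v' S > v' T

/-- `v` is a nice cancelable valuation: cancelable, and some non-degenerate
cancelable valuation respects it. -/
def NiceCancelable {ι : Type*} [DecidableEq ι] (v : Finset ι → ℝ) : Prop :=
  Cancelable v ∧ ∃ v' : Finset ι → ℝ,
    IsValuation v' ∧ NonDegenerate v' ∧ Cancelable v' ∧ Respects v' v

/-- A partial allocation: the bundles are pairwise disjoint. -/
def IsPartialAlloc {ι : Type*} {n : ℕ} (X : Fin n → Finset ι) : Prop :=
  ∀ i j : Fin n, i ≠ j → Disjoint (X i) (X j)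

/-- The set of unallocated items. -/
def unalloc {ι : Type*} [DecidableEq ι] [Fintype ι] {n : ℕ}
    (X : Fin n → Finset ι) : Finset ι :=
  Finset.univ \ Finset.univ.biUnion X

/-- Agent `i` envies the set `S`. -/
def EnviesSet {ι : Type*} {n : ℕ} (v : Fin n → Finset ι → ℝ) (X : Fin n → Finset ι)
    (i : Fin n) (S : Finset ι) : Prop :=
  v i (X i) < v i S

/-- Agent `i` strongly envies the set `S`. -/
def StrongEnviesSet {ι : Type*} [DecidableEq ι] {n : ℕ} (v : Fin n → Finset ι → ℝ)
    (X : Fin n → Finset ι) (i : Fin n) (S : Finset ι) : Prop :=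
  ∃ h ∈ S, v i (X i) < v i (S.erase h)

/-- The allocation is EFX: no agent strongly envies another agent's bundle. -/
def IsEFX {ι : Type*} [DecidableEq ι] {n : ℕ} (v : Fin n → Finset ι → ℝ)
    (X : Fin n → Finset ι) : Prop :=
  ∀ i j : Fin n, i ≠ j → ¬ StrongEnviesSet v X i (X j)

/-- `Y` Pareto dominates `X`. -/
def ParetoDominates {ι : Type*} {n : ℕ} (v : Fin n → Finset ι → ℝ)
    (Y X : Fin n → Finset ι) : Prop :=
  (∀ i, v i (X i) ≤ v i (Y i)) ∧ ∃ i, v i (X i) < v i (Y i)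

/-- `Y` dominates `X` lexicographically with respect to the ordering `a` of the agents. -/
def Dominates {ι : Type*} {n : ℕ} (v : Fin n → Finset ι → ℝ) (a : Fin n → Fin n)
    (Y X : Fin n → Finset ι) : Prop :=
  ∃ k : Fin n, (∀ j : Fin n, j < k → v (a j) (Y (a j)) = v (a j) (X (a j))) ∧
    v (a k) (X (a k)) < v (a k) (Y (a k))

/-- Agent `i` is a most envious agent of the set `S`: there is `T ⊆ S` that `i`
envies and that no agent strongly envies.  (`S \ T` is a corresponding discard set.) -/
def MostEnvious {ι : Type*} [DecidableEq ι] {n : ℕ} (v : Fin n → Finset ι → ℝ)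
    (X : Fin n → Finset ι) (i : Fin n) (S : Finset ι) : Prop :=
  ∃ T ⊆ S, EnviesSet v X i T ∧ ∀ j : Fin n, ¬ StrongEnviesSet v X j T

/-- `i` champions `j` with respect to the item `g`:  `i` is a most envious agent
of `X j ∪ {g}`. -/
def ChampG {ι : Type*} [DecidableEq ι] {n : ℕ} (v : Fin n → Finset ι → ℝ)
    (X : Fin n → Finset ι) (g : ι) (i j : Fin n) : Prop :=
  MostEnvious v X i (insert g (X j))

/-- `i` champions `j` with respect to `(H | S)`:  `H ⊆ M \ X j`, `S ⊆ X j`, and `i`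
is a most envious agent of `(X j \ S) ∪ H`. -/
def GenChamp {ι : Type*} [DecidableEq ι] {n : ℕ} (v : Fin n → Finset ι → ℝ)
    (X : Fin n → Finset ι) (i j : Fin n) (H S : Finset ι) : Prop :=
  Disjoint H (X j) ∧ S ⊆ X j ∧ MostEnvious v X i ((X j \ S) ∪ H)

/-- A good `g`-cycle for the partial EFX allocation `X`: a cycle of `k ≥ 2`
distinct agents all of whose edges are `g`-champion edges, with no parallel envy
edges and no internal `g`-champion edges, together with the induced
`g`-decompositions `X (a t) = T t ∪ B t`: `B t` is the (bottom half-bundle)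
discard set of the edge from the predecessor of `a t` into `a t`, so `a t`
envies `(X (a (t+1)) \ B (t+1)) ∪ {g}` and no agent strongly envies it. -/
structure GoodCycle {ι : Type*} [DecidableEq ι] [Fintype ι] {n : ℕ}
    (v : Fin n → Finset ι → ℝ) (X : Fin n → Finset ι) (g : ι) where
  k : ℕ
  two_le : 2 ≤ k
  a : ZMod k → Fin n
  inj : Function.Injective a
  champ : ∀ t : ZMod k, ChampG v X g (a t) (a (t + 1))
  no_envy : ∀ t : ZMod k, ¬ EnviesSet v X (a t) (X (a (t + 1)))
  no_internal : ∀ t s : ZMod k, ChampG v X g (a t) (a s) → s = t + 1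
  B : ZMod k → Finset ι
  B_sub : ∀ t : ZMod k, B t ⊆ X (a t)
  g_notin_B : ∀ t : ZMod k, g ∉ B t
  B_envy : ∀ t : ZMod k, EnviesSet v X (a t) (insert g (X (a (t + 1)) \ B (t + 1)))
  B_no_strong : ∀ (t : ZMod k) (j : Fin n),
    ¬ StrongEnviesSet v X j (insert g (X (a (t + 1)) \ B (t + 1)))

lemma Cancelable.union_le_union {ι : Type*} [DecidableEq ι] {v : Finset ι → ℝ}
    (hc : Cancelable v) {S T R : Finset ι} (h : v S ≤ v T)
    (hS : Disjoint S R) (hT : Disjoint T R) : v (S ∪ R) ≤ v (T ∪ R) := by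
  induction R using Finset.induction_on with
  | empty => simpa using h
  | insert x R hx ih =>
    rw [disjoint_insert_right] at hS hT
    rw [union_insert, union_insert]
    by_contra! hlt
    exact (ih hS.2 hT.2).not_gt
      (hc _ _ x (by simp [hS.1, hx]) (by simp [hT.1, hx]) hlt)

/-- If some agent envies `S`, then `S` has a most envious agent. -/
lemma exists_mostEnvious {ι : Type*} [DecidableEq ι] {n : ℕ}
    {v : Fin n → Finset ι → ℝ} {X : Fin n → Finset ι} {i : Fin n} {S : Finset ι}
    (h : EnviesSet v X i S) : ∃ j, MostEnvious v X j S := by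
  classical
  obtain ⟨T, hT, hmin⟩ := exists_min_image
    (S.powerset.filter fun T => ∃ j, EnviesSet v X j T) Finset.card
    ⟨S, mem_filter.2 ⟨mem_powerset_self S, i, h⟩⟩
  obtain ⟨hTS, j, hj⟩ := mem_filter.1 hT
  rw [mem_powerset] at hTS
  refine ⟨j, T, hTS, hj, ?_⟩
  rintro l ⟨x, hx, hl⟩
  exact (card_erase_lt_of_mem hx).not_ge <| hmin _ <|
    mem_filter.2 ⟨mem_powerset.2 ((erase_subset x T).trans hTS), l, hl⟩

lemma MostEnvious.enviesSet {ι : Type*} [DecidableEq ι] {n : ℕ}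
    {v : Fin n → Finset ι → ℝ} {X : Fin n → Finset ι} {i : Fin n} {S : Finset ι}
    (h : MostEnvious v X i S) (hmono : ∀ ⦃S T : Finset ι⦄, S ⊆ T → v i S ≤ v i T) :
    EnviesSet v X i S := by
  obtain ⟨T, hTS, hT, -⟩ := h
  exact lt_of_lt_of_le hT (hmono hTS)

namespace GoodCycle

variable {ι : Type*} [DecidableEq ι] [Fintype ι] {n : ℕ}
  {v : Fin n → Finset ι → ℝ} {X : Fin n → Finset ι} {g : ι}

/-- An agent on the cycle envies `T s ∪ {g}` only for its own successor. -/
lemma insert_top_le (C : GoodCycle v X g) {r s : ZMod C.k} (hs : s ≠ r + 1) :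
    v (C.a r) (insert g (X (C.a s) \ C.B s)) ≤ v (C.a r) (X (C.a r)) := by
  by_contra! h
  refine hs (C.no_internal r s ⟨_, insert_subset_insert g sdiff_subset, h, ?_⟩)
  simpa using C.B_no_strong (s - 1)

/-- Each agent on the cycle likes its successor's top half-bundle best. -/
lemma top_le_succ_top (C : GoodCycle v X g) (hc : ∀ i, Cancelable (v i))
    (hg : ∀ j, g ∉ X j) (r s : ZMod C.k) :
    v (C.a r) (X (C.a s) \ C.B s) ≤ v (C.a r) (X (C.a (r + 1)) \ C.B (r + 1)) := by
  by_cases hs : s = r + 1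
  · rw [hs]
  · exact (hc (C.a r) _ _ g (fun h => hg _ (sdiff_subset h)) (fun h => hg _ (sdiff_subset h))
      ((C.insert_top_le hs).trans_lt (C.B_envy r))).le

/-- Each agent on the cycle values its own bottom half-bundle at least as much as `g`. -/
lemma singleton_le_bottom (C : GoodCycle v X g) (hnd : ∀ i, NonDegenerate (v i))
    (hc : ∀ i, Cancelable (v i)) (hg : ∀ j, g ∉ X j) (t : ZMod C.k) :
    v (C.a t) {g} ≤ v (C.a t) (C.B t) := by
  have : Fact (1 < C.k) := ⟨C.two_le⟩
  by_contra! h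
  have hle := (hc (C.a t)).union_le_union h.le (R := X (C.a t) \ C.B t)
    disjoint_sdiff (disjoint_singleton_left.2 fun h => hg _ (sdiff_subset h))
  rw [union_sdiff_of_subset (C.B_sub t), ← insert_eq] at hle
  have heq := hle.antisymm (C.insert_top_le (by simp))
  refine hg (C.a t) ?_
  rw [not_imp_not.1 (hnd _ _ _) heq]
  exact mem_insert_self _ _

end GoodCycle

/-- If `q` lies on the directed path from `t` to `r` in `ZMod k`, then `t` lies on the
directed path from `r + 1` to `q`. -/
lemma val_sub_succ_le {k : ℕ} [NeZero k] {q r t : ZMod k}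
    (h : (q - t).val ≤ (r - t).val) : (t - (r + 1)).val ≤ (q - (r + 1)).val := by
  have hsum : (t - (r + 1)).val + (r - t).val < k := by
    by_contra! hk
    have hadd := ZMod.val_add_val_of_le hk
    have hneg : t - (r + 1) + (r - t) = -1 := by ring
    have hlt := ZMod.val_lt (t - (r + 1))
    have hlt' := ZMod.val_lt (r - t)
    obtain ⟨m, rfl⟩ := Nat.exists_eq_succ_of_ne_zero (NeZero.ne k)
    rw [hneg, ZMod.val_neg_one] at hadd
    omega
  have hadd := ZMod.val_add_of_lt ((Nat.add_le_add_left h _).trans_lt hsum)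
  rw [show t - (r + 1) + (q - t) = q - (r + 1) by ring] at hadd
  omega

/-- Let `C` be a good `g`-cycle for a partial EFX allocation `X`
(agents with non-degenerate cancelable valuations, `g` unallocated).  Then for
every agent `a t` on the cycle there is either a good `B t`-edge — agents
`a r`, `a s` on the cycle with `a r ▷_{B t | B s} a s` and `a t` lying on the
directed path from `a s` to `a r` along `C` — or an external `B t`-edge — an
agent `b` not on `C` with `b ▷_{B t | B s} a s` for some `a s` on `C`. -/
theorem good_cycle_good_or_external_edge
    {ι : Type*} [DecidableEq ι] [Fintype ι] {n : ℕ}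
    (v : Fin n → Finset ι → ℝ) (hval : ∀ i, IsValuation (v i))
    (hnd : ∀ i, NonDegenerate (v i)) (hc : ∀ i, Cancelable (v i))
    (X : Fin n → Finset ι) (hX : IsPartialAlloc X) (hEFX : IsEFX v X)
    (g : ι) (hg : g ∈ unalloc X) (C : GoodCycle v X g) :
    ∀ t : ZMod C.k,
      (∃ r s : ZMod C.k, GenChamp v X (C.a r) (C.a s) (C.B t) (C.B s) ∧
        (t - s).val ≤ (r - s).val) ∨
      (∃ b : Fin n, (∀ r : ZMod C.k, C.a r ≠ b) ∧
        ∃ s : ZMod C.k, GenChamp v X b (C.a s) (C.B t) (C.B s)) := by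
  classical
  intro t
  have : Fact (1 < C.k) := ⟨C.two_le⟩
  have : NeZero C.k := ⟨by have := C.two_le; omega⟩
  have hgX (j : Fin n) : g ∉ X j := by
    simp only [unalloc, mem_sdiff, mem_univ, mem_biUnion, true_and, not_exists] at hg
    exact hg j
  have hdisj {s : ZMod C.k} (hs : s ≠ t) : Disjoint (X (C.a s)) (C.B t) :=
    (hX _ _ (C.inj.ne hs)).mono_right (C.B_sub t)
  have hdisjT (s : ZMod C.k) : Disjoint (X (C.a s) \ C.B s) (C.B t) := by
    by_cases hs : s = t
    · exact hs ▸ sdiff_disjoint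
    · exact (hdisj hs).mono_left sdiff_subset
  -- Start with an agent preferring `B t` to `g`, then maximize the distance from `t`.
  have hstart : t ∈ univ.filter fun r : ZMod C.k =>
      r + 1 ≠ t ∧ EnviesSet v X (C.a r) ((X (C.a (r + 1)) \ C.B (r + 1)) ∪ C.B t) := by
    have hne : t + 1 ≠ t := by simp
    refine mem_filter.2 ⟨mem_univ _, hne, (C.B_envy t).trans_le ?_⟩
    have hle := (hc (C.a t)).union_le_union (C.singleton_le_bottom hnd hc hgX t)
      (R := X (C.a (t + 1)) \ C.B (t + 1))
      (disjoint_singleton_left.2 fun h => hgX _ (sdiff_subset h)) (hdisjT (t + 1)).symm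
    rwa [← insert_eq, union_comm] at hle
  obtain ⟨r, hr, hmax⟩ := exists_max_image _ (fun r : ZMod C.k => (r - t).val) ⟨t, hstart⟩
  obtain ⟨hrt, henvy⟩ := (mem_filter.1 hr).2
  obtain ⟨b, hb⟩ := exists_mostEnvious henvy
  have hchamp : GenChamp v X b (C.a (r + 1)) (C.B t) (C.B (r + 1)) :=
    ⟨(hdisj hrt).symm, C.B_sub _, hb⟩
  by_cases hbC : ∀ q : ZMod C.k, C.a q ≠ b
  · exact Or.inr ⟨b, hbC, r + 1, hchamp⟩
  push Not at hbC
  obtain ⟨q, rfl⟩ := hbC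
  have hq : EnviesSet v X (C.a q) ((X (C.a (q + 1)) \ C.B (q + 1)) ∪ C.B t) :=
    (hb.enviesSet (hval _).2.2).trans_le <|
      (hc _).union_le_union (C.top_le_succ_top hc hgX q (r + 1)) (hdisjT _) (hdisjT _)
  have hqt : q + 1 ≠ t := by
    rintro rfl
    rw [sdiff_union_of_subset (C.B_sub _)] at hq
    exact C.no_envy q hq
  exact Or.inl ⟨q, r + 1, hchamp, val_sub_succ_le (hmax q (by simp [hqt, hq]))⟩

end FairDivision
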